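/- If G is Sidorenko then the 1-subdivision of G is Sidorenko: for all graphs H, hom(G', H) · v(H)^{e(G) - v(G)} ≥ (hom(K₂,H)/v(H)²)^{2e(G)} · v(H)^{v(G)+e(G)} in density form, i.e. t(G', H) ≥ t(K₂,H)^{2e(G)}. -/

import Mathlib

open Finset
open scoped Classical

/-- The homomorphism density `t(G, H)`: the probability that a uniformly random map
`V(G) → V(H)` is a graph homomorphism. -/
noncomputable def homDensity {V W : Type} [Fintype V] [Fintype W]
    (G : SimpleGraph V) (H : SimpleGraph W) : ℝ :=
  ((Finset.univ.filter
      (fun f : V → W => ∀ ⦃u v : V⦄, G.Adj u v → H.Adj (f u) (f v))).card : ℝ) /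
    (Fintype.card W : ℝ) ^ (Fintype.card V)

/-- The 1-subdivision of a graph `G`: each edge is replaced by a path of length two
through a new vertex. -/
def subdivision {V : Type} (G : SimpleGraph V) : SimpleGraph (V ⊕ G.edgeSet) :=
  SimpleGraph.fromRel (fun x y =>
    match x, y with
    | .inl v, .inr e => v ∈ (e : Sym2 V)
    | _, _ => False)

/-- weighted homomorphism count -/
noncomputable def wS {V X : Type} [Fintype V] [Fintype X] (G : SimpleGraph V) (c : Sym2 X → ℝ) : ℝ :=
  ∑ f : V → X, ∏ e ∈ G.edgeFinset, c (e.map f)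

noncomputable def wT {X : Type} [Fintype X] (c : Sym2 X → ℝ) : ℝ :=
  ∑ x : X, ∑ y : X, c s(x, y)

lemma sum_equiv_any {A B : Type} (iA : Fintype A) (iB : Fintype B) (e : A ≃ B) (f : A → ℝ)
    (g : B → ℝ) (h : ∀ a, f a = g (e a)) : ∑ a, f a = ∑ b, g b :=
  Fintype.sum_equiv e f g h

lemma homDensity_K2 {W : Type} [Fintype W] (H : SimpleGraph W) :
    homDensity (⊤ : SimpleGraph (Fin 2)) H =
      (∑ x : W, ∑ y : W, if H.Adj x y then (1:ℝ) else 0) / (Fintype.card W : ℝ) ^ 2 := by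
  unfold homDensity
  rw [Fintype.card_fin]
  congr 1
  rw [Finset.card_filter]
  push_cast
  rw [← Fintype.sum_prod_type']
  apply sum_equiv_any _ _ (finTwoArrowEquiv W)
  intro f
  apply if_congr _ rfl rfl
  simp only [finTwoArrowEquiv_apply]
  constructor
  · intro h
    exact h (by simp)
  · intro h u v huv
    fin_cases u <;> fin_cases v <;> simp_all [H.adj_comm]

lemma ind_prod_le {V W : Type} [Fintype V] (G : SimpleGraph V) (R : Sym2 W → Prop) (f : V → W)
    (P : Prop) [Decidable P] (h : P → ∀ u v, G.Adj u v → R s(f u, f v)) :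
    (if P then (1:ℝ) else 0) ≤ ∏ e ∈ G.edgeFinset, if R (e.map f) then (1:ℝ) else 0 := by
  split_ifs with hP
  · rw [Finset.prod_eq_one]
    intro e he
    induction e using Sym2.ind with
    | _ u v =>
      rw [if_pos]
      exact h hP u v (by simpa using he)
  · exact Finset.prod_nonneg (fun e _ => by split_ifs <;> norm_num)

def dbl {X : Type} (R : Sym2 X → Prop) : SimpleGraph (X × Bool) where
  Adj p q := R s(p.1, q.1) ∧ p.2 ≠ q.2
  symm := ⟨fun p q h => ⟨by rw [Sym2.eq_swap]; exact h.1, h.2.symm⟩⟩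
  loopless := ⟨fun p h => h.2 rfl⟩

lemma step1 {V : Type} [Fintype V] (G : SimpleGraph V)
    (hG : ∀ (W : Type) [Fintype W] (H : SimpleGraph W),
      homDensity G H ≥ homDensity (⊤ : SimpleGraph (Fin 2)) H ^ G.edgeFinset.card)
    (X : Type) [Fintype X] [Nonempty X] (R : Sym2 X → Prop) :
    wT (fun s => if R s then 1 else 0) ^ G.edgeFinset.card * (Fintype.card X : ℝ) ^ Fintype.card V
      ≤ wS G (fun s => if R s then 1 else 0) * (2 * (Fintype.card X : ℝ) ^ 2) ^ G.edgeFinset.card := by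
  have h := hG (X × Bool) (dbl R)
  rw [homDensity_K2] at h
  have hT : (∑ x : X × Bool, ∑ y : X × Bool, if (dbl R).Adj x y then (1:ℝ) else 0)
      = 2 * wT (fun s => if R s then 1 else 0) := by
    simp only [wT, Fintype.sum_prod_type, dbl, Fintype.sum_bool, Finset.mul_sum]
    apply Finset.sum_congr rfl
    intro x _
    rw [← Finset.sum_add_distrib]
    apply Finset.sum_congr rfl
    intro y _
    by_cases hR : R s(x, y) <;> simp [hR]
    norm_num
  have hN : (0:ℝ) < Fintype.card X := by exact_mod_cast Fintype.card_pos
  have hS : homDensity G (dbl R) ≤ wS G (fun s => if R s then 1 else 0) / (Fintype.card X : ℝ) ^ Fintype.card V := by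
    unfold homDensity
    rw [Fintype.card_prod, Fintype.card_bool]
    push_cast
    rw [mul_pow, ← div_div, div_right_comm]
    apply div_le_div_of_nonneg_right _ (by positivity)
    rw [div_le_iff₀ (by positivity), Finset.card_filter]
    push_cast
    calc _ ≤ ∑ f : V → X × Bool, ∏ e ∈ G.edgeFinset, (if R (e.map (fun v => (f v).1)) then (1:ℝ) else 0) := by
            apply Finset.sum_le_sum
            intro f _
            apply ind_prod_le
            intro h u v huv
            exact (h huv).1
      _ = ∑ p : (V → X) × (V → Bool), ∏ e ∈ G.edgeFinset, (if R (e.map p.1) then (1:ℝ) else 0) := by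
            rw [← (Equiv.arrowProdEquivProdArrow V (fun _ => X) (fun _ => Bool)).sum_comp]
            rfl
      _ = _ := by
            rw [Fintype.sum_prod_type]
            simp only [wS, Finset.sum_mul, Finset.sum_const, Finset.card_univ, nsmul_eq_mul]
            apply Finset.sum_congr rfl
            intro f _
            rw [mul_comm]
            simp
  have h2 := le_trans h hS
  rw [hT, Fintype.card_prod, Fintype.card_bool, le_div_iff₀ (by positivity)] at h2
  push_cast at h2
  have e1 : 2 * wT (fun s => if R s then 1 else 0) / ((Fintype.card X : ℝ) * 2) ^ 2
      = wT (fun s => if R s then 1 else 0) / (2 * (Fintype.card X : ℝ) ^ 2) := by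
    field_simp
  rw [e1, div_pow, div_mul_eq_mul_div, div_le_iff₀ (by positivity)] at h2
  exact h2

lemma wS_nonneg {V X : Type} [Fintype V] [Fintype X] (G : SimpleGraph V) (c : Sym2 X → ℝ)
    (hc : ∀ s, 0 ≤ c s) : 0 ≤ wS G c :=
  Finset.sum_nonneg fun _ _ => Finset.prod_nonneg fun _ _ => hc _

lemma wT_nonneg {X : Type} [Fintype X] (c : Sym2 X → ℝ)
    (hc : ∀ s, 0 ≤ c s) : 0 ≤ wT c :=
  Finset.sum_nonneg fun _ _ => Finset.sum_nonneg fun _ _ => hc _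

lemma step2 {V : Type} [Fintype V] (G : SimpleGraph V)
    (hG : ∀ (W : Type) [Fintype W] (H : SimpleGraph W),
      homDensity G H ≥ homDensity (⊤ : SimpleGraph (Fin 2)) H ^ G.edgeFinset.card)
    (X : Type) [Fintype X] [Nonempty X] (c : Sym2 X → ℕ) (B : ℕ) (hB : ∀ s, c s < 2 ^ (B + 1)) :
    wT (fun s => (c s : ℝ)) ^ G.edgeFinset.card * (Fintype.card X : ℝ) ^ Fintype.card V
      ≤ wS G (fun s => (c s : ℝ)) * ((Fintype.card X : ℝ) ^ 2) ^ G.edgeFinset.card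
        * (4 * ((B:ℝ) + 1)) ^ G.edgeFinset.card := by
  obtain ⟨L, hL⟩ : ∃ L : ℕ → Sym2 X → Prop, ∀ j s, L j s ↔ c s ≠ 0 ∧ Nat.log 2 (c s) = j :=
    ⟨fun j s => c s ≠ 0 ∧ Nat.log 2 (c s) = j, fun _ _ => Iff.rfl⟩
  have hpt : ∀ s, (c s : ℝ) ≤ ∑ j ∈ Finset.range (B + 1), 2 ^ (j + 1) * (if L j s then (1:ℝ) else 0) := by
    intro s
    by_cases h0 : c s = 0
    · simp [hL, h0]
    · have hj : Nat.log 2 (c s) ∈ Finset.range (B + 1) := by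
        rw [Finset.mem_range]
        exact Nat.log_lt_of_lt_pow h0 (hB s)
      refine le_trans ?_ (Finset.single_le_sum (fun j _ => by positivity) hj)
      rw [if_pos ((hL _ _).2 ⟨h0, rfl⟩), mul_one]
      exact_mod_cast (Nat.lt_pow_succ_log_self (by norm_num) (c s)).le
  have hTsum : wT (fun s => (c s : ℝ)) ≤ ∑ j ∈ Finset.range (B + 1),
      2 ^ (j + 1) * wT (fun s => if L j s then (1:ℝ) else 0) := by
    calc wT (fun s => (c s : ℝ)) ≤ ∑ x : X, ∑ y : X, ∑ j ∈ Finset.range (B + 1), 2 ^ (j + 1) * (if L j s(x,y) then (1:ℝ) else 0) :=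
          Finset.sum_le_sum fun x _ => Finset.sum_le_sum fun y _ => hpt _
      _ = _ := by
          simp only [wT, Finset.mul_sum]
          rw [Finset.sum_comm]
          simp_rw [Finset.sum_comm (s := Finset.univ (α := X)) (t := Finset.range (B+1))]
          apply Finset.sum_congr rfl
          intro j _
          rw [Finset.sum_comm]
  obtain ⟨j, _, hj⟩ : ∃ j ∈ Finset.range (B + 1), wT (fun s => (c s : ℝ)) / (B + 1) ≤
      2 ^ (j + 1) * wT (fun s => if L j s then (1:ℝ) else 0) := by
    apply Finset.exists_le_of_sum_le (by simp)
    refine le_trans (le_of_eq ?_) hTsum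
    rw [Finset.sum_const, Finset.card_range, nsmul_eq_mul]
    push_cast
    field_simp
  have h1 := step1 G hG X (L j)
  have hSj : (2 ^ j) ^ G.edgeFinset.card * wS G (fun s => if L j s then (1:ℝ) else 0) ≤ wS G (fun s => (c s : ℝ)) := by
    unfold wS
    rw [Finset.mul_sum]
    apply Finset.sum_le_sum
    intro f _
    rw [← Finset.prod_const, ← Finset.prod_mul_distrib]
    apply Finset.prod_le_prod
    · intro e _
      positivity
    · intro e _
      dsimp only
      split_ifs with h
      · rw [hL] at h
        rw [mul_one]
        have := Nat.pow_log_le_self 2 h.1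
        rw [h.2] at this
        exact_mod_cast this
      · simp
  set S := wS G (fun s => (c s : ℝ))
  set T := wT (fun s => (c s : ℝ)) with hTdef
  have hT0 : 0 ≤ T := wT_nonneg _ (fun s => by positivity)
  set Sj := wS G (fun s => if L j s then (1:ℝ) else 0)
  set Tj := wT (fun s => if L j s then (1:ℝ) else 0)
  set n := G.edgeFinset.card
  set N : ℝ := (Fintype.card X : ℝ)
  have hT2 : T ≤ (B + 1) * (2 ^ (j+1) * Tj) := by
    rwa [div_le_iff₀' (by positivity)] at hj
  calc T ^ n * N ^ Fintype.card V ≤ ((B + 1) * (2 ^ (j+1) * Tj)) ^ n * N ^ Fintype.card V := by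
        gcongr
    _ = ((B + 1) * 2 ^ (j + 1)) ^ n * (Tj ^ n * N ^ Fintype.card V) := by
        simp only [mul_pow]; ring
    _ ≤ ((B + 1) * 2 ^ (j + 1)) ^ n * (Sj * (2 * N ^ 2) ^ n) :=
        mul_le_mul_of_nonneg_left h1 (by positivity)
    _ = ((2 ^ j) ^ n * Sj) * (N^2)^n * (4 * ((B:ℝ) + 1)) ^ n := by
        have : (4:ℝ)^n = 2^n * 2^n := by rw [← mul_pow]; norm_num
        simp only [mul_pow, this]; ring
    _ ≤ _ := by gcongr

lemma wS_tensor {V X : Type} [Fintype V] [Fintype X] (G : SimpleGraph V) (c : Sym2 X → ℝ) (k : ℕ) :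
    wS G (fun s : Sym2 (Fin k → X) => ∏ i, c (s.map (fun x => x i))) = wS G c ^ k := by
  unfold wS
  rw [Fintype.sum_pow, ← (Equiv.piComm (fun (_ : V) (_ : Fin k) => X)).sum_comp]
  apply Finset.sum_congr rfl
  intro f _
  rw [Finset.prod_comm]
  apply Finset.prod_congr rfl
  intro i _
  apply Finset.prod_congr rfl
  intro e _
  rw [Sym2.map_map]
  rfl

lemma wT_tensor {X : Type} [Fintype X] (c : Sym2 X → ℝ) (k : ℕ) :
    wT (fun s : Sym2 (Fin k → X) => ∏ i, c (s.map (fun x => x i))) = wT c ^ k := by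
  unfold wT
  rw [← Fintype.sum_prod_type', ← Fintype.sum_prod_type', Fintype.sum_pow,
    ← (Equiv.arrowProdEquivProdArrow (Fin k) (fun _ => X) (fun _ => X)).sum_comp]
  rfl

lemma limit_arg (a b : ℝ) (n e : ℕ) (ha : 0 ≤ a)
    (h : ∀ k : ℕ, b ^ k ≤ a ^ k * (4 * (((n * k : ℕ) : ℝ) + 1)) ^ e) : b ≤ a := by
  by_contra! hab
  have hb : 0 < b := lt_of_le_of_lt ha hab
  have hr : |a / b| < 1 := by
    rw [abs_of_nonneg (by positivity), div_lt_one hb]; exact hab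
  have ht := (tendsto_pow_const_mul_const_pow_of_abs_lt_one e hr).const_mul ((4 * ((n:ℝ) + 1)) ^ e)
  rw [mul_zero] at ht
  have hev := ht.eventually_lt_const (show (0:ℝ) < 1 by norm_num)
  obtain ⟨k, hk1, hk⟩ := ((Filter.eventually_ge_atTop 1).and hev).exists
  have h2 := h k
  have hk1' : (1:ℝ) ≤ k := by exact_mod_cast hk1
  have h3 : b ^ k ≤ a ^ k * ((4 * ((n:ℝ) + 1)) ^ e * (k:ℝ) ^ e) := by
    refine h2.trans ?_
    rw [← mul_pow]
    have h5 : 4 * (((n * k : ℕ) : ℝ) + 1) ≤ 4 * ((n:ℝ) + 1) * k := by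
      push_cast
      nlinarith
    exact mul_le_mul_of_nonneg_left (pow_le_pow_left₀ (by positivity) h5 e) (by positivity)
  have h4 : (1:ℝ) ≤ (4 * ((n:ℝ) + 1)) ^ e * ((k:ℝ) ^ e * (a / b) ^ k) := by
    rw [div_pow, ← mul_assoc, ← mul_div_assoc, le_div_iff₀ (by positivity)]
    linarith
  linarith

lemma step3 {V : Type} [Fintype V] (G : SimpleGraph V)
    (hG : ∀ (W : Type) [Fintype W] (H : SimpleGraph W),
      homDensity G H ≥ homDensity (⊤ : SimpleGraph (Fin 2)) H ^ G.edgeFinset.card)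
    (X : Type) [Fintype X] [Nonempty X] (c : Sym2 X → ℕ) (n : ℕ) (hn : ∀ s, c s ≤ n) :
    wT (fun s => (c s : ℝ)) ^ G.edgeFinset.card * (Fintype.card X : ℝ) ^ Fintype.card V
      ≤ wS G (fun s => (c s : ℝ)) * ((Fintype.card X : ℝ) ^ 2) ^ G.edgeFinset.card := by
  apply limit_arg _ _ n G.edgeFinset.card
  · have := wS_nonneg G (fun s => (c s : ℝ)) (fun s => by positivity)
    positivity
  intro k
  have h := step2 G hG (Fin k → X) (fun s => ∏ i, c (s.map (fun x => x i))) (n * k) (by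
    intro s
    calc ∏ i, c (s.map (fun x => x i)) ≤ ∏ i : Fin k, 2 ^ n :=
          Finset.prod_le_prod' fun i _ => (hn _).trans Nat.lt_two_pow_self.le
      _ = 2 ^ (n * k) := by simp [pow_mul]
      _ < 2 ^ (n * k + 1) := Nat.pow_lt_pow_right (by norm_num) (by omega))
  push_cast at h
  rw [wS_tensor G (fun s => (c s : ℝ)) k, wT_tensor (fun s => (c s : ℝ)) k] at h
  simp only [Fintype.card_pi, Finset.prod_const, Finset.card_univ, Fintype.card_fin] at h
  push_cast at h
  convert h using 1
  · rw [mul_pow]; congr 1 <;> (simp only [← pow_mul]; congr 1; ring)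
  · congr 1
    · rw [mul_pow]; congr 1; (simp only [← pow_mul]; congr 1; ring)
    · push_cast; rfl

noncomputable def codeg {W : Type} [Fintype W] (H : SimpleGraph W) (s : Sym2 W) : ℕ :=
  (Finset.univ.filter (fun w => ∀ x ∈ s, H.Adj x w)).card

lemma wT_codeg {W : Type} [Fintype W] (H : SimpleGraph W) :
    (∑ x : W, ∑ y : W, if H.Adj x y then (1:ℝ) else 0) ^ 2
      ≤ (Fintype.card W : ℝ) * wT (fun s => (codeg H s : ℝ)) := by
  have : wT (fun s => (codeg H s : ℝ)) = ∑ w : W, (∑ x : W, if H.Adj x w then (1:ℝ) else 0) ^ 2 := by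
    unfold wT codeg
    simp_rw [Finset.card_filter, sq, Finset.sum_mul_sum]
    push_cast
    rw [Finset.sum_comm' (t' := Finset.univ) (s' := fun _ => Finset.univ) (by simp)]
    rw [Finset.sum_comm]
    conv_rhs => rw [Finset.sum_comm]
    apply Finset.sum_congr rfl
    intro x _
    conv_rhs => rw [Finset.sum_comm]
    apply Finset.sum_congr rfl
    intro y _
    apply Finset.sum_congr rfl
    intro w _
    by_cases h1 : H.Adj x w <;> by_cases h2 : H.Adj y w <;> simp [h1, h2]
  rw [this, Finset.sum_comm]
  exact sq_sum_le_card_mul_sum_sq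

lemma subdivision_hom_iff {V W : Type} (G : SimpleGraph V) (H : SimpleGraph W)
    (f : V ⊕ G.edgeSet → W) :
    (∀ ⦃u v⦄, (subdivision G).Adj u v → H.Adj (f u) (f v)) ↔
      ∀ e : G.edgeSet, ∀ x ∈ (e : Sym2 V).map (fun v => f (.inl v)), H.Adj x (f (.inr e)) := by
  constructor
  · intro h e x hx
    rw [Sym2.mem_map] at hx
    obtain ⟨v, hv, rfl⟩ := hx
    apply h
    simp [subdivision, hv]
  · rintro h (u | u) (v | v) huv
    · simp [subdivision] at huv
    · simp [subdivision] at huv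
      exact h v _ (Sym2.mem_map.2 ⟨u, huv, rfl⟩)
    · simp [subdivision] at huv
      exact (h u _ (Sym2.mem_map.2 ⟨v, huv, rfl⟩)).symm
    · simp [subdivision] at huv

lemma prod_edge {V : Type} [Fintype V] (G : SimpleGraph V) {i : Fintype G.edgeSet}
    [j : Fintype G.edgeSet] (F : Sym2 V → ℝ) :
    ∏ e ∈ @SimpleGraph.edgeFinset V G i, F e = ∏ e : G.edgeSet, F e :=
  Finset.prod_subtype _ (fun x => @SimpleGraph.mem_edgeFinset V G x i) F

lemma subdivision_count {V W : Type} [Fintype V] [Fintype W] (G : SimpleGraph V) (H : SimpleGraph W) :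
    homDensity (subdivision G) H = wS G (fun s => (codeg H s : ℝ)) /
      (Fintype.card W : ℝ) ^ (Fintype.card V + G.edgeFinset.card) := by
  unfold homDensity
  congr 1
  · rw [Finset.card_filter]
    push_cast
    simp_rw [subdivision_hom_iff]
    trans ∑ p : (V → W) × (G.edgeSet → W),
      if ∀ e : G.edgeSet, ∀ x ∈ (e : Sym2 V).map p.1, H.Adj x (p.2 e) then (1:ℝ) else 0
    · apply sum_equiv_any _ _ (Equiv.sumArrowEquivProdArrow V G.edgeSet W)
      intro f
      apply if_congr _ rfl rfl
      rfl
    rw [Fintype.sum_prod_type]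
    unfold wS
    apply Finset.sum_congr rfl
    intro f _
    have e1 : ∏ e ∈ G.edgeFinset, (codeg H (e.map f) : ℝ) = ∏ e : G.edgeSet, (codeg H ((e : Sym2 V).map f) : ℝ) := by
      exact prod_edge G (fun e => (codeg H (e.map f) : ℝ))
    rw [e1]
    unfold codeg
    simp_rw [Finset.card_filter]
    push_cast
    rw [Finset.prod_univ_sum, Fintype.piFinset_univ]
    apply Finset.sum_congr rfl
    intro g _
    rw [Finset.prod_ite_zero]
    simp
  · rw [Fintype.card_sum, SimpleGraph.edgeFinset_card]

/-- If `G` is Sidorenko, then its 1-subdivision is Sidorenko. -/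
theorem subdivision_sidorenko {V : Type} [Fintype V] (G : SimpleGraph V)
    (hG : ∀ (W : Type) [Fintype W] (H : SimpleGraph W),
      homDensity G H ≥ homDensity (⊤ : SimpleGraph (Fin 2)) H ^ G.edgeFinset.card) :
    ∀ (W : Type) [Fintype W] (H : SimpleGraph W),
      homDensity (subdivision G) H
        ≥ homDensity (⊤ : SimpleGraph (Fin 2)) H ^ (2 * G.edgeFinset.card) := by
  intro W _ H
  have hW := hG W H
  rw [homDensity_K2] at hW ⊢
  rw [subdivision_count]
  rcases isEmpty_or_nonempty W with hE | hE
  · have hc : Fintype.card W = 0 := Fintype.card_eq_zero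
    by_cases he : G.edgeFinset.card = 0
    · rw [he] at hW ⊢
      by_cases hV : Fintype.card V = 0
      · have : IsEmpty V := Fintype.card_eq_zero_iff.1 hV
        have he' : G.edgeFinset = ∅ := Finset.card_eq_zero.1 he
        simp [wS, he']
      · exfalso
        unfold homDensity at hW
        rw [hc] at hW
        norm_num [hV] at hW
    · have : (2 * G.edgeFinset.card) ≠ 0 := by omega
      simp [he]
  · have hN : (0:ℝ) < Fintype.card W := by exact_mod_cast Fintype.card_pos
    have h3 := step3 G hG W (codeg H) (Fintype.card W) (fun s => Finset.card_le_univ _)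
    have h4 := wT_codeg H
    set D := ∑ x : W, ∑ y : W, if H.Adj x y then (1:ℝ) else 0
    set S := wS G (fun s => (codeg H s : ℝ))
    set T := wT (fun s => (codeg H s : ℝ))
    set n := G.edgeFinset.card
    set N : ℝ := (Fintype.card W : ℝ)
    rw [ge_iff_le, div_pow, div_le_div_iff₀ (by positivity) (by positivity)]
    calc D ^ (2 * n) * N ^ (Fintype.card V + n) = (D ^ 2) ^ n * N ^ (Fintype.card V + n) := by rw [pow_mul]
      _ ≤ (N * T) ^ n * N ^ (Fintype.card V + n) := by gcongr
      _ = (T ^ n * N ^ Fintype.card V) * (N ^ 2) ^ n := by rw [mul_pow, pow_add]; ring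
      _ ≤ (S * (N ^ 2) ^ n) * (N ^ 2) ^ n := by gcongr
      _ = S * (N ^ 2) ^ (2 * n) := by ring
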